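/- Let x ∈ [0,1] and define ψ : ℕ → [0,∞) by ψ(n) = nx if n is the square of a prime and ψ(n) = 0 otherwise. Then the Lebesgue measure of 𝔄^∞(ψ) equals x, while the Lebesgue measure of 𝔎^∞(ψ) equals min{2x, 1}. -/

import Mathlib

open MeasureTheory Filter Set

namespace DS

/-- The set `𝔄^∞(ψ)`: the set of `α ∈ [0,1]` such that `|α - a/b| ≤ ψ(|ab|)/|ab|` for
infinitely many reduced fractions `a/b` with `a ∈ ℤ ∖ {0}`, `b ∈ ℕ`, `gcd(a,b) = 1`. -/
def fAR (ψ : ℕ → ℝ) : Set ℝ :=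
  {α : ℝ | α ∈ Set.Icc (0 : ℝ) 1 ∧
    {q : ℤ × ℕ | q.1 ≠ 0 ∧ 0 < q.2 ∧ Int.gcd q.1 q.2 = 1 ∧
      |α - (q.1 : ℝ) / (q.2 : ℝ)| ≤ ψ (q.1.natAbs * q.2) / (q.1.natAbs * q.2 : ℝ)}.Infinite}

/-- The set `𝔎^∞(ψ)`: the set of `α ∈ [0,1]` such that `|α - a/b| ≤ ψ(|ab|)/|ab|` for
infinitely many pairs `(a, b) ∈ (ℤ ∖ {0}) × ℕ`. -/
def fKR (ψ : ℕ → ℝ) : Set ℝ :=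
  {α : ℝ | α ∈ Set.Icc (0 : ℝ) 1 ∧
    {q : ℤ × ℕ | q.1 ≠ 0 ∧ 0 < q.2 ∧
      |α - (q.1 : ℝ) / (q.2 : ℝ)| ≤ ψ (q.1.natAbs * q.2) / (q.1.natAbs * q.2 : ℝ)}.Infinite}

lemma key (x : ℝ) (ψ : ℕ → ℝ)
    (h1 : ∀ q : ℕ, q.Prime → ψ (q ^ 2) = ((q ^ 2 : ℕ) : ℝ) * x)
    (h2 : ∀ n : ℕ, ¬ (∃ q : ℕ, q.Prime ∧ n = q ^ 2) → ψ n = 0) (α : ℝ)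
    (hα : α ∉ Set.range ((↑) : ℚ → ℝ)) (a : ℤ) (b : ℕ)
    (h : |α - (a : ℝ) / (b : ℝ)| ≤ ψ (a.natAbs * b) / (a.natAbs * b : ℝ)) :
    |α - (a : ℝ) / (b : ℝ)| ≤ x ∧ ∃ p : ℕ, p.Prime ∧ a.natAbs * b = p ^ 2 := by
  by_cases hp : ∃ p : ℕ, p.Prime ∧ a.natAbs * b = p ^ 2
  · refine ⟨?_, hp⟩
    obtain ⟨p, hp, e⟩ := hp
    have e' : (a.natAbs * b : ℝ) = ((p ^ 2 : ℕ) : ℝ) := by rw [← e]; push_cast; rfl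
    have hpos : (((p ^ 2 : ℕ) : ℝ)) ≠ 0 := by
      have := hp.pos
      positivity
    rw [e', e, h1 p hp, mul_div_cancel_left₀ _ hpos] at h
    exact h
  · exfalso
    rw [h2 _ hp, zero_div] at h
    have h0 := abs_nonpos_iff.1 h
    apply hα
    refine ⟨(a : ℚ) / (b : ℚ), ?_⟩
    push_cast
    linarith

lemma fin_set (x : ℝ) (hx : x ∈ Set.Icc (0 : ℝ) 1) (α : ℝ) (hα : α ∈ Set.Icc (0 : ℝ) 1)
    (hxα : x < α) :
    {q : ℤ × ℕ | q.1.natAbs ≠ q.2 ∧ |α - (q.1 : ℝ) / (q.2 : ℝ)| ≤ x ∧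
      ∃ p : ℕ, p.Prime ∧ q.1.natAbs * q.2 = p ^ 2}.Finite := by
  obtain ⟨M, hM⟩ := exists_nat_gt (max 2 (1 / (α - x)))
  have hM2 : (2 : ℝ) < M := lt_of_le_of_lt (le_max_left _ _) hM
  have hM3 : 1 / (α - x) < M := lt_of_le_of_lt (le_max_right _ _) hM
  refine Set.Finite.subset
    ((Set.finite_Icc (-(M : ℤ)) M).prod (Set.finite_Iic M)) ?_
  rintro ⟨a, b⟩ ⟨hne, hle, p, hp, e⟩
  simp only at hne hle e
  suffices h : a.natAbs ≤ M ∧ b ≤ M by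
    simp only [Set.mem_prod, Set.mem_Icc, Set.mem_Iic]
    omega
  have hM2' : 2 < M := by exact_mod_cast hM2
  obtain ⟨i, hi, rfl⟩ := (Nat.dvd_prime_pow hp).1 (Dvd.intro_left _ e)
  have hp0 := hp.pos
  rw [abs_le] at hle
  have habs : |(a : ℝ)| = (a.natAbs : ℝ) := by rw [Nat.cast_natAbs]; simp
  interval_cases i
  · have ea : a.natAbs = p ^ 2 := by simpa using e
    rw [ea] at habs
    simp only [pow_zero, Nat.cast_one, div_one] at hle
    have h3 : |(a : ℝ)| ≤ 2 := by
      rw [abs_le]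
      constructor <;> linarith [hle.1, hle.2, hx.1, hx.2, hα.1, hα.2]
    rw [habs] at h3
    have h4 : p ^ 2 ≤ 2 := by exact_mod_cast h3
    rw [pow_zero]
    omega
  · exfalso
    apply hne
    rw [pow_one, pow_two] at e
    rw [pow_one]
    exact Nat.eq_of_mul_eq_mul_right hp0 e
  · have ea : a.natAbs = 1 := by
      have : 0 < p ^ 2 := by positivity
      exact Nat.eq_of_mul_eq_mul_right this (by simpa using e)
    refine ⟨by omega, ?_⟩
    rw [ea, Nat.cast_one] at habs
    have hpp : (0 : ℝ) < ((p ^ 2 : ℕ) : ℝ) := by positivity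
    have h3 : α - x ≤ 1 / ((p ^ 2 : ℕ) : ℝ) := by
      have : (a : ℝ) / ((p ^ 2 : ℕ) : ℝ) ≤ 1 / ((p ^ 2 : ℕ) : ℝ) := by
        gcongr
        rw [← habs]; exact le_abs_self _
      linarith [hle.2]
    have h4 : ((p ^ 2 : ℕ) : ℝ) < M := by
      refine lt_of_le_of_lt ?_ hM3
      rw [le_div_iff₀ hpp] at h3
      rw [le_div_iff₀ (by linarith)]
      linarith
    exact_mod_cast h4.le

lemma inf_set (x : ℝ) (ψ : ℕ → ℝ)
    (h1 : ∀ q : ℕ, q.Prime → ψ (q ^ 2) = ((q ^ 2 : ℕ) : ℝ) * x) (hx : x ∈ Set.Icc (0 : ℝ) 1) :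
    Set.Ico 0 x ⊆ fAR ψ := by
  rintro α ⟨h0, hαx⟩
  refine ⟨⟨h0, by linarith [hx.2]⟩, ?_⟩
  obtain ⟨M, hM⟩ := exists_nat_gt (1 / x)
  have hx0 : 0 < x := by linarith
  have hinf : {p : ℕ | p.Prime ∧ M < p}.Infinite := by
    rw [Set.infinite_iff_exists_gt]
    intro n
    obtain ⟨p, hp, hpp⟩ := Nat.exists_infinite_primes (n + M + 1)
    exact ⟨p, ⟨hpp, by omega⟩, by omega⟩
  refine (hinf.image (f := fun p : ℕ => ((1 : ℤ), p ^ 2)) ?_).mono ?_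
  · intro p _ q _ h
    simpa using h
  · rintro _ ⟨p, ⟨hp, hpM⟩, rfl⟩
    have hp0 := hp.pos
    have hpp : (0 : ℝ) < ((p ^ 2 : ℕ) : ℝ) := by positivity
    refine ⟨one_ne_zero, by positivity, by simp, ?_⟩
    simp only [Int.natAbs_one, one_mul, h1 p hp, Nat.cast_one, Int.cast_one]
    rw [mul_div_cancel_left₀ _ hpp.ne']
    have hle : 1 / ((p ^ 2 : ℕ) : ℝ) ≤ x := by
      rw [div_le_iff₀ hpp]
      rw [div_lt_iff₀ hx0] at hM
      have : (M : ℝ) ≤ ((p ^ 2 : ℕ) : ℝ) := by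
        exact_mod_cast (by nlinarith : M ≤ p ^ 2)
      nlinarith
    have : 0 < 1 / ((p ^ 2 : ℕ) : ℝ) := by positivity
    rw [abs_le]
    constructor <;> linarith

lemma inf_set2 (x : ℝ) (ψ : ℕ → ℝ)
    (h1 : ∀ q : ℕ, q.Prime → ψ (q ^ 2) = ((q ^ 2 : ℕ) : ℝ) * x) (hx : x ∈ Set.Icc (0 : ℝ) 1) :
    Set.Icc (1 - x) 1 ⊆ fKR ψ := by
  rintro α ⟨h0, hα1⟩
  refine ⟨⟨by linarith [hx.2], hα1⟩, ?_⟩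
  refine (Nat.infinite_setOfPred_prime.image (f := fun p : ℕ => ((p : ℤ), p)) ?_).mono ?_
  · intro p _ q _ h
    simpa using h
  · rintro _ ⟨p, hp, rfl⟩
    have hp0 := Nat.Prime.pos hp
    have hpp : (0 : ℝ) < ((p ^ 2 : ℕ) : ℝ) := by positivity
    have hpr : (p : ℝ) ≠ 0 := by positivity
    refine ⟨by simpa using hp0.ne', hp0, ?_⟩
    have e : ((p : ℤ).natAbs * p : ℝ) = ((p ^ 2 : ℕ) : ℝ) := by simp [pow_two]
    simp only [e]
    rw [Int.natAbs_natCast, ← pow_two, h1 p hp, mul_div_cancel_left₀ _ hpp.ne', Int.cast_natCast,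
      div_self hpr, abs_le]
    constructor <;> linarith [hx.1]

lemma fAR_sub (ψ : ℕ → ℝ) : fAR ψ ⊆ fKR ψ := by
  rintro α ⟨h, hi⟩
  exact ⟨h, hi.mono fun q hq => ⟨hq.1, hq.2.1, hq.2.2.2⟩⟩

lemma vol_union (s : Set ℝ) : volume (s ∪ Set.range ((↑) : ℚ → ℝ)) = volume s := by
  refine le_antisymm ((measure_union_le _ _).trans ?_) (measure_mono Set.subset_union_left)
  rw [(Set.countable_range _).measure_zero, add_zero]

/-- With `ψ(n) = n·x` when `n` is the square of a prime and `ψ(n) = 0` otherwise,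
`𝔄^∞(ψ)` has Lebesgue measure `x` while `𝔎^∞(ψ)` has Lebesgue measure `min{2x, 1}`. -/
theorem prime_square_example (x : ℝ) (hx : x ∈ Set.Icc (0 : ℝ) 1) (ψ : ℕ → ℝ)
    (h1 : ∀ q : ℕ, q.Prime → ψ (q ^ 2) = ((q ^ 2 : ℕ) : ℝ) * x)
    (h2 : ∀ n : ℕ, ¬ (∃ q : ℕ, q.Prime ∧ n = q ^ 2) → ψ n = 0) :
    volume (fAR ψ) = ENNReal.ofReal x ∧
      volume (fKR ψ) = ENNReal.ofReal (min (2 * x) 1) := by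
  have hA : fAR ψ ⊆ Set.Icc 0 x ∪ Set.range ((↑) : ℚ → ℝ) := by
    rintro α ⟨hα, hi⟩
    by_contra hc
    rw [Set.mem_union, not_or] at hc
    obtain ⟨hc1, hc2⟩ := hc
    have hxα : x < α := by
      by_contra h
      exact hc1 ⟨hα.1, not_lt.1 h⟩
    refine hi ((fin_set x hx α hα hxα).subset ?_)
    rintro ⟨a, b⟩ ⟨_, _, hg, hle⟩
    obtain ⟨k1, p, hp, e⟩ := key x ψ h1 h2 α hc2 a b hle
    refine ⟨?_, k1, p, hp, e⟩
    intro hab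
    simp only at hab hg
    rw [Int.gcd, Int.natAbs_natCast, hab, Nat.gcd_self] at hg
    rw [hab, hg] at e
    have := hp.two_le
    nlinarith
  have hK : fKR ψ ⊆ (Set.Icc 0 x ∪ Set.Icc (1 - x) 1) ∪ Set.range ((↑) : ℚ → ℝ) := by
    rintro α ⟨hα, hi⟩
    by_contra hc
    rw [Set.mem_union, Set.mem_union, not_or, not_or] at hc
    obtain ⟨⟨hc1, hc3⟩, hc2⟩ := hc
    have hxα : x < α := by
      by_contra h
      exact hc1 ⟨hα.1, not_lt.1 h⟩
    have hxα' : α < 1 - x := by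
      by_contra h
      exact hc3 ⟨not_lt.1 h, hα.2⟩
    refine hi ((fin_set x hx α hα hxα).subset ?_)
    rintro ⟨a, b⟩ ⟨_, hb, hle⟩
    obtain ⟨k1, p, hp, e⟩ := key x ψ h1 h2 α hc2 a b hle
    refine ⟨?_, k1, p, hp, e⟩
    intro hab
    simp only at hab hb
    have hbr : (b : ℝ) ≠ 0 := by positivity
    rw [abs_le] at k1
    have hcase : a = (b : ℤ) ∨ a = -(b : ℤ) := by omega
    rcases hcase with rfl | rfl
    · rw [Int.cast_natCast, div_self hbr] at k1
      linarith [k1.1]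
    · rw [Int.cast_neg, Int.cast_natCast, neg_div, div_self hbr] at k1
      linarith [k1.2, hx.2, hx.1, hα.1]
  have hsub := inf_set x ψ h1 hx
  have hsub2 := inf_set2 x ψ h1 hx
  constructor
  · apply le_antisymm
    · refine (measure_mono hA).trans ?_
      rw [vol_union, Real.volume_Icc, sub_zero]
    · refine le_trans ?_ (measure_mono hsub)
      rw [Real.volume_Ico, sub_zero]
  · apply le_antisymm
    · refine (measure_mono hK).trans ?_
      rw [vol_union]
      rcases le_total (2 * x) 1 with h | h
      · rw [min_eq_left h]
        refine (measure_union_le _ _).trans ?_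
        rw [Real.volume_Icc, Real.volume_Icc, ← ENNReal.ofReal_add (by linarith [hx.1])
          (by linarith [hx.1])]
        apply ENNReal.ofReal_le_ofReal
        linarith
      · rw [min_eq_right h]
        have : Set.Icc 0 x ∪ Set.Icc (1 - x) 1 ⊆ Set.Icc (0 : ℝ) 1 := by
          rintro y (hy | hy)
          · exact ⟨hy.1, hy.2.trans hx.2⟩
          · exact ⟨by linarith [hy.1, hx.2], hy.2⟩
        refine (measure_mono this).trans ?_
        rw [Real.volume_Icc, sub_zero]
    · refine le_trans ?_ (measure_mono (Set.union_subset (hsub.trans (fAR_sub ψ)) hsub2))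
      rcases le_total (2 * x) 1 with h | h
      · rw [min_eq_left h, measure_union _ measurableSet_Icc, Real.volume_Ico, Real.volume_Icc,
          ← ENNReal.ofReal_add (by linarith [hx.1]) (by linarith [hx.1])]
        · apply ENNReal.ofReal_le_ofReal
          linarith
        · rw [Set.disjoint_left]
          intro y hy hy'
          linarith [hy.2, hy'.1]
      · rw [min_eq_right h]
        have : Set.Ico (0 : ℝ) 1 ⊆ Set.Ico 0 x ∪ Set.Icc (1 - x) 1 := by
          intro y hy
          by_cases hyx : y < x
          · exact Or.inl ⟨hy.1, hyx⟩
          · exact Or.inr ⟨by linarith [not_lt.1 hyx], hy.2.le⟩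
        refine le_trans ?_ (measure_mono this)
        rw [Real.volume_Ico, sub_zero]

end DS
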